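/- Let p ∈ (2,∞). Then there exist weights w, σ on ℝ with [σ]_{A_∞} < ∞ and [w,σ]_{A_p} < ∞, and a function f ∈ L^p(σ) with supp(f) ⊆ [0,1], such that S(fσ) ∉ L^p(w), where S is the dyadic square function on ℝ (and S may even be taken to be the dyadic square function over [0,1)). -/

import Mathlib

open MeasureTheory Set Filter
open scoped ENNReal NNReal

noncomputable section

/-- Average of `g` over the interval `[a, b)` (with respect to Lebesgue measure). -/
def avgI (g : ℝ → ℝ) (a b : ℝ) : ℝ := (b - a)⁻¹ * ∫ x in Set.Ico a b, g x

/-- The dyadic interval `[k·2^{-n}, (k+1)·2^{-n})`. -/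
def dyadicI (n k : ℤ) : Set ℝ :=
  Set.Ico ((k : ℝ) * (2:ℝ) ^ (-n)) (((k : ℝ) + 1) * (2:ℝ) ^ (-n))

/-- Average of `g` over the dyadic interval `dyadicI n k`. -/
def avgD (g : ℝ → ℝ) (n k : ℤ) : ℝ :=
  avgI g ((k : ℝ) * (2:ℝ) ^ (-n)) (((k : ℝ) + 1) * (2:ℝ) ^ (-n))

/-- The martingale difference `Δ_Q g` associated with the dyadic interval `Q = dyadicI n k`:
`Δ_Q g = Σ_{R child of Q} ⟨g⟩_R 1_R − ⟨g⟩_Q 1_Q`. -/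
def deltaD (g : ℝ → ℝ) (n k : ℤ) (x : ℝ) : ℝ :=
  (dyadicI (n+1) (2*k)).indicator (fun _ => avgD g (n+1) (2*k)) x
    + (dyadicI (n+1) (2*k+1)).indicator (fun _ => avgD g (n+1) (2*k+1)) x
    - (dyadicI n k).indicator (fun _ => avgD g n k) x

/-- The dyadic square function on `ℝ`. -/
def sqFn (g : ℝ → ℝ) (x : ℝ) : ℝ :=
  Real.sqrt (∑' q : ℤ × ℤ, (deltaD g q.1 q.2 x) ^ 2)

open Classical in
/-- The dyadic square function over `[0,1)`: the sum runs only over dyadic intervals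
contained in `[0,1)`. -/
def sqFn01 (g : ℝ → ℝ) (x : ℝ) : ℝ :=
  Real.sqrt (∑' q : ℤ × ℤ,
    if dyadicI q.1 q.2 ⊆ Set.Ico (0:ℝ) 1 then (deltaD g q.1 q.2 x) ^ 2 else 0)

/-- `‖g‖_{L^p(w)}` (as an extended nonnegative real), `w dx` being the underlying measure. -/
def pNorm (p : ℝ) (g w : ℝ → ℝ) : ℝ≥0∞ :=
  (∫⁻ x : ℝ, ENNReal.ofReal (|g x| ^ p * w x)) ^ (1/p)

/-- `‖g‖_{L^p(w)}` over `[0,1)`. -/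
def pNorm01 (p : ℝ) (g w : ℝ → ℝ) : ℝ≥0∞ :=
  (∫⁻ x in Set.Ico (0:ℝ) 1, ENNReal.ofReal (|g x| ^ p * w x)) ^ (1/p)

/-- The joint `A_p` characteristic `[w,σ]_{A_p}`, the supremum running over all bounded
intervals of `ℝ`. -/
def apChar (p : ℝ) (w σ : ℝ → ℝ) : ℝ≥0∞ :=
  ⨆ (a : ℝ) (b : ℝ) (_ : a < b),
    ENNReal.ofReal (avgI w a b * (avgI σ a b) ^ (p - 1))

/-- The joint `A_p` characteristic `[w,σ]_{A_p}`, the supremum running over all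
subintervals of `[0,1)`. -/
def apChar01 (p : ℝ) (w σ : ℝ → ℝ) : ℝ≥0∞ :=
  ⨆ (a : ℝ) (b : ℝ) (_ : 0 ≤ a) (_ : a < b) (_ : b ≤ 1),
    ENNReal.ofReal (avgI w a b * (avgI σ a b) ^ (p - 1))

/-- The local maximal function `M_{[a,b)} σ (x) = sup { ⟨σ⟩_R : R interval ⊆ [a,b), x ∈ R }`. -/
def maxFn (σ : ℝ → ℝ) (a b x : ℝ) : ℝ≥0∞ :=
  ⨆ (c : ℝ) (e : ℝ) (_ : a ≤ c) (_ : c < e) (_ : e ≤ b) (_ : x ∈ Set.Ico c e),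
    ENNReal.ofReal (avgI σ c e)

/-- The Fujii–Wilson `A_∞` characteristic
`[σ]_{A_∞} = sup_Q (1/σ(Q)) ∫_Q M_Q σ`, the supremum over bounded intervals of `ℝ`. -/
def ainfChar (σ : ℝ → ℝ) : ℝ≥0∞ :=
  ⨆ (a : ℝ) (b : ℝ) (_ : a < b),
    (∫⁻ x in Set.Ico a b, maxFn σ a b x) / ENNReal.ofReal (∫ x in Set.Ico a b, σ x)

/-- A weight on `ℝ`: measurable, a.e. positive, integrable over every bounded interval. -/
def IsWeight (w : ℝ → ℝ) : Prop :=
  Measurable w ∧ (∀ᵐ x : ℝ, 0 < w x) ∧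
    ∀ a b : ℝ, a < b → IntegrableOn w (Set.Ico a b)

/-- A weight on `[0,1)`: measurable, a.e. positive on `[0,1)`, integrable over `[0,1)`. -/
def IsWeight01 (w : ℝ → ℝ) : Prop :=
  Measurable w ∧ (∀ᵐ x : ℝ, x ∈ Set.Ico (0:ℝ) 1 → 0 < w x) ∧
    IntegrableOn w (Set.Ico (0:ℝ) 1)


/-- The index of the dyadic shell `2 ^ j ≤ |x| < 2 ^ (j + 1)` that contains `x ≠ 0`. -/
def shell (x : ℝ) : ℤ := Int.log 2 |x|

/-- The function equal to `(1 + |j|) ^ (-s)` on the `j`-th dyadic shell. -/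
def shellDecay (s x : ℝ) : ℝ := (1 + |(shell x : ℝ)|) ^ (-s)

/-- The function equal to `2 ^ (-j) * (1 + |j|) ^ (-s)` on the `j`-th dyadic shell. -/
def shellWeight (s x : ℝ) : ℝ := (2 : ℝ) ^ (-shell x) * shellDecay s x

/-- The restriction of `shellDecay β` to the shells in `(0, 1)` with even index. -/
def evenShellFn (β x : ℝ) : ℝ :=
  if 0 < x ∧ x < 1 ∧ Even (shell x) then shellDecay β x else 0

theorem measurable_shell : Measurable shell := by
  have h : shell = fun x => ⌊Real.logb 2 |x|⌋ := by
    funext x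
    have := Real.floor_logb_natCast (b := 2) (r := |x|) (abs_nonneg x)
    rw [shell, ← this]
    norm_num
  rw [h]
  exact ((Real.measurable_log.comp measurable_norm).div_const _).floor

theorem measurable_shellDecay (s : ℝ) : Measurable (shellDecay s) :=
  (measurable_from_top (f := fun j : ℤ => (1 + |(j : ℝ)|) ^ (-s))).comp measurable_shell

theorem measurable_shellWeight (s : ℝ) : Measurable (shellWeight s) :=
  (measurable_from_top
    (f := fun j : ℤ => (2 : ℝ) ^ (-j) * (1 + |(j : ℝ)|) ^ (-s))).comp measurable_shell

theorem measurable_evenShellFn (β : ℝ) : Measurable (evenShellFn β) := by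
  refine Measurable.ite ?_ (measurable_shellDecay β) measurable_const
  refine measurableSet_Ioi.inter (measurableSet_Iio.inter ?_)
  exact measurable_shell (MeasurableSet.of_discrete (s := {j : ℤ | Even j}))

theorem shellDecay_pos (s x : ℝ) : 0 < shellDecay s x := by
  unfold shellDecay; positivity

theorem shellDecay_le_one {s : ℝ} (hs : 0 ≤ s) (x : ℝ) : shellDecay s x ≤ 1 :=
  Real.rpow_le_one_of_one_le_of_nonpos (by simp) (by linarith)

theorem shellWeight_pos (s x : ℝ) : 0 < shellWeight s x :=
  mul_pos (by positivity) (shellDecay_pos s x)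

theorem evenShellFn_nonneg (β x : ℝ) : 0 ≤ evenShellFn β x := by
  unfold evenShellFn
  split_ifs
  exacts [(shellDecay_pos β x).le, le_rfl]

theorem evenShellFn_le (β x : ℝ) : evenShellFn β x ≤ shellDecay β x := by
  unfold evenShellFn
  split_ifs
  exacts [le_rfl, (shellDecay_pos β x).le]

theorem zpow_shell_le {x : ℝ} (hx : x ≠ 0) : (2 : ℝ) ^ shell x ≤ |x| := by
  simpa [shell] using Int.zpow_log_le_self (b := 2) (r := |x|) (by norm_num) (abs_pos.2 hx)

theorem abs_lt_zpow_shell (x : ℝ) : |x| < (2 : ℝ) ^ (shell x + 1) := by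
  simpa [shell] using Int.lt_zpow_succ_log_self (b := 2) (by norm_num) |x|

theorem zpow_neg_shell_le {x : ℝ} (hx : x ≠ 0) : (2 : ℝ) ^ (-shell x) ≤ 2 / |x| := by
  have h := abs_lt_zpow_shell x
  rw [zpow_add_one₀ two_ne_zero] at h
  rw [zpow_neg, le_div_iff₀ (abs_pos.2 hx), inv_mul_le_iff₀ (by positivity)]
  exact h.le

theorem inv_abs_le_zpow_neg_shell {x : ℝ} (hx : x ≠ 0) : |x|⁻¹ ≤ (2 : ℝ) ^ (-shell x) := by
  rw [zpow_neg]
  exact inv_anti₀ (by positivity) (zpow_shell_le hx)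

theorem shell_eq {j : ℤ} {x : ℝ} (h : x ∈ Ico ((2 : ℝ) ^ j) ((2 : ℝ) ^ (j + 1))) :
    shell x = j := by
  have hx : 0 < x := lt_of_lt_of_le (by positivity) h.1
  have h1 := zpow_shell_le hx.ne'
  have h2 := abs_lt_zpow_shell x
  rw [abs_of_pos hx] at h1 h2
  have h3 := (zpow_lt_zpow_iff_right₀ (one_lt_two (α := ℝ))).1 (h1.trans_lt h.2)
  have h4 := (zpow_lt_zpow_iff_right₀ (one_lt_two (α := ℝ))).1 (h.1.trans_lt h2)
  omega

theorem lintegral_shellWeight_lt_top {s : ℝ} (hs : 1 < s) :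
    ∫⁻ x, ENNReal.ofReal (shellWeight s x) < ⊤ := by
  have hsum : Summable fun j : ℤ => 4 * (1 + |(j : ℝ)|) ^ (-s) := by
    refine Summable.mul_left _ ?_
    have hn : Summable fun n : ℕ => (1 + (n : ℝ)) ^ (-s) := by
      have := (summable_nat_add_iff 1).2 (Real.summable_nat_rpow.2 (neg_lt_neg hs))
      refine this.congr fun n => ?_
      push_cast
      rw [add_comm]
    exact Summable.of_nat_of_neg (by simpa using hn) (by simpa using hn)
  have hmap : ∫⁻ x, ENNReal.ofReal (shellWeight s x) =
      ∑' j : ℤ, ENNReal.ofReal ((2 : ℝ) ^ (-j) * (1 + |(j : ℝ)|) ^ (-s)) *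
        volume (shell ⁻¹' {j}) := by
    have h := lintegral_map (μ := volume) (g := shell)
      (f := fun j : ℤ => ENNReal.ofReal ((2 : ℝ) ^ (-j) * (1 + |(j : ℝ)|) ^ (-s)))
      measurable_from_top measurable_shell
    rw [lintegral_countable'] at h
    simp_rw [Measure.map_apply measurable_shell (measurableSet_singleton _)] at h
    exact h.symm
  rw [hmap]
  refine lt_of_le_of_lt (ENNReal.tsum_le_tsum fun j => ?_) hsum.tsum_ofReal_lt_top
  have hvol : volume (shell ⁻¹' {j}) ≤ ENNReal.ofReal (4 * (2 : ℝ) ^ j) := by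
    have hsub : shell ⁻¹' {j} ⊆ Icc (-(2 : ℝ) ^ (j + 1)) ((2 : ℝ) ^ (j + 1)) := by
      rintro x rfl
      exact abs_le.1 (abs_lt_zpow_shell x).le
    refine (measure_mono hsub).trans_eq ?_
    rw [Real.volume_Icc, zpow_add_one₀ two_ne_zero]
    ring_nf
  refine (mul_le_mul_right hvol _).trans_eq ?_
  rw [← ENNReal.ofReal_mul (by positivity), zpow_neg]
  congr 1
  field_simp

theorem integrable_shellWeight {s : ℝ} (hs : 1 < s) : Integrable (shellWeight s) :=
  (lintegral_ofReal_ne_top_iff_integrable (measurable_shellWeight s).aestronglyMeasurable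
    (ae_of_all _ fun x => (shellWeight_pos s x).le)).1 (lintegral_shellWeight_lt_top hs).ne

theorem isWeight_shellWeight {s : ℝ} (hs : 1 < s) : IsWeight (shellWeight s) :=
  ⟨measurable_shellWeight s, ae_of_all _ (shellWeight_pos s),
    fun _ _ _ => (integrable_shellWeight hs).integrableOn⟩

theorem shellWeight_le {s x : ℝ} (hs : 0 ≤ s) (hx : x ≠ 0) : shellWeight s x ≤ 2 / |x| :=
  (mul_le_of_le_one_right (by positivity) (shellDecay_le_one hs x)).trans (zpow_neg_shell_le hx)

theorem avgI_le {g : ℝ → ℝ} {a b C : ℝ} (hab : a < b) (hg : IntegrableOn g (Ico a b))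
    (hC : ∀ x ∈ Ico a b, g x ≤ C) : avgI g a b ≤ C := by
  have h : ∫ x in Ico a b, g x ≤ ∫ _ in Ico a b, C :=
    setIntegral_mono_on hg (by simp) measurableSet_Ico hC
  rw [setIntegral_const, measureReal_def, Real.volume_Ico,
    ENNReal.toReal_ofReal (sub_pos.2 hab).le, smul_eq_mul] at h
  rw [avgI, inv_mul_le_iff₀ (sub_pos.2 hab)]
  exact h

theorem continuous_abs_rpow {γ : ℝ} (hγ : 0 < γ) : Continuous fun x : ℝ => |x| ^ γ :=
  continuous_abs.rpow_const fun _ => Or.inr hγ.le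

theorem integrableOn_abs_rpow {γ : ℝ} (hγ : 0 < γ) (a b : ℝ) :
    IntegrableOn (fun x : ℝ => |x| ^ γ) (Ico a b) :=
  ((continuous_abs_rpow hγ).integrableOn_Icc).mono_set Ico_subset_Icc_self

theorem isWeight_abs_rpow {γ : ℝ} (hγ : 0 < γ) : IsWeight fun x : ℝ => |x| ^ γ := by
  refine ⟨(continuous_abs_rpow hγ).measurable, ?_, fun a b _ => integrableOn_abs_rpow hγ a b⟩
  filter_upwards [compl_mem_ae_iff.2 (measure_singleton (0 : ℝ))] with x hx
  exact Real.rpow_pos_of_pos (abs_pos.2 hx) _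

theorem max_abs_pos {a b : ℝ} (hab : a < b) : 0 < max |a| |b| := by
  rcases eq_or_ne a 0 with rfl | ha
  · exact lt_max_of_lt_right (abs_pos.2 hab.ne')
  · exact lt_max_of_lt_left (abs_pos.2 ha)

theorem abs_rpow_le_max {γ a b x : ℝ} (hγ : 0 < γ) (hx : x ∈ Ico a b) :
    |x| ^ γ ≤ max |a| |b| ^ γ :=
  Real.rpow_le_rpow (abs_nonneg x) (abs_le_max_abs_abs hx.1 hx.2.le) hγ.le

theorem avgI_abs_rpow_le {γ a b : ℝ} (hγ : 0 < γ) (hab : a < b) :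
    avgI (fun x => |x| ^ γ) a b ≤ max |a| |b| ^ γ :=
  avgI_le hab (integrableOn_abs_rpow hγ a b) fun _ hx => abs_rpow_le_max hγ hx

/-- A quarter of any interval `[a, b)` lies in `{|x| ≥ max |a| |b| / 2}`. -/
theorem exists_quarter_Ico {a b : ℝ} (hab : a < b) :
    ∃ c, Ico c (c + (b - a) / 4) ⊆ Ico a b ∧
      ∀ x ∈ Ico c (c + (b - a) / 4), max |a| |b| / 2 ≤ |x| := by
  rcases le_total |a| |b| with h | h
  · rw [max_eq_right h]
    have hb : 0 < b := by
      by_contra! hb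
      rw [abs_of_nonpos hb, abs_of_nonpos (by linarith)] at h
      linarith
    rw [abs_of_pos hb] at h ⊢
    have := neg_le_of_abs_le h
    refine ⟨b - (b - a) / 4, fun x hx => ⟨?_, ?_⟩, fun x hx => ?_⟩
    · linarith [hx.1]
    · linarith [hx.2]
    · exact le_trans (by linarith [hx.1]) (le_abs_self x)
  · rw [max_eq_left h]
    have ha : a < 0 := by
      by_contra! ha
      rw [abs_of_nonneg ha, abs_of_nonneg (by linarith)] at h
      linarith
    rw [abs_of_neg ha] at h ⊢
    have := le_of_abs_le h
    refine ⟨a, fun x hx => ⟨hx.1, ?_⟩, fun x hx => ?_⟩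
    · linarith [hx.2]
    · exact le_trans (by linarith [hx.2]) (neg_le_abs x)

theorem le_setIntegral_abs_rpow {γ a b : ℝ} (hγ : 0 < γ) (hab : a < b) :
    (b - a) / 4 * (max |a| |b| / 2) ^ γ ≤ ∫ x in Ico a b, |x| ^ γ := by
  obtain ⟨c, hc, hlow⟩ := exists_quarter_Ico hab
  have hR := max_abs_pos hab
  have h1 : ∫ _ in Ico c (c + (b - a) / 4), (max |a| |b| / 2) ^ γ ≤
      ∫ x in Ico c (c + (b - a) / 4), |x| ^ γ :=
    setIntegral_mono_on (by simp) (integrableOn_abs_rpow hγ _ _) measurableSet_Ico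
      fun x hx => Real.rpow_le_rpow (by positivity) (hlow x hx) hγ.le
  rw [setIntegral_const, measureReal_def, Real.volume_Ico, add_sub_cancel_left,
    ENNReal.toReal_ofReal (by linarith), smul_eq_mul] at h1
  refine h1.trans (setIntegral_mono_set (integrableOn_abs_rpow hγ a b) ?_ hc.eventuallyLE)
  exact ae_of_all _ fun x => by positivity

theorem ainfChar_abs_rpow_lt_top {γ : ℝ} (hγ : 0 < γ) :
    ainfChar (fun x => |x| ^ γ) < ⊤ := by
  refine lt_of_le_of_lt (b := ENNReal.ofReal (4 * 2 ^ γ)) ?_ ENNReal.ofReal_lt_top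
  refine iSup_le fun a => iSup_le fun b => iSup_le fun hab => ?_
  have hR := max_abs_pos hab
  have hmax : ∀ x, maxFn (fun x => |x| ^ γ) a b x ≤ ENNReal.ofReal (max |a| |b| ^ γ) := by
    intro x
    refine iSup_le fun c => iSup_le fun e => iSup_le fun hac => iSup_le fun hce =>
      iSup_le fun heb => iSup_le fun _ => ENNReal.ofReal_le_ofReal ?_
    exact avgI_le hce (integrableOn_abs_rpow hγ c e) fun y hy =>
      abs_rpow_le_max hγ ⟨hac.trans hy.1, hy.2.trans_le heb⟩
  refine ENNReal.div_le_of_le_mul ?_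
  calc ∫⁻ x in Ico a b, maxFn (fun x => |x| ^ γ) a b x
      ≤ ∫⁻ _ in Ico a b, ENNReal.ofReal (max |a| |b| ^ γ) := lintegral_mono hmax
    _ = ENNReal.ofReal (max |a| |b| ^ γ * (b - a)) := by
        rw [setLIntegral_const, Real.volume_Ico, ENNReal.ofReal_mul (by positivity)]
    _ = ENNReal.ofReal (4 * 2 ^ γ * ((b - a) / 4 * (max |a| |b| / 2) ^ γ)) := by
        rw [Real.div_rpow hR.le zero_le_two]
        congr 1
        field_simp
    _ ≤ ENNReal.ofReal (4 * 2 ^ γ) * ENNReal.ofReal (∫ x in Ico a b, |x| ^ γ) := by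
        rw [← ENNReal.ofReal_mul (by positivity)]
        gcongr
        exact le_setIntegral_abs_rpow hγ hab

theorem apChar_lt_top {p : ℝ} (hp : 1 < p) {w : ℝ → ℝ} (hw : Integrable w)
    (hw0 : ∀ x, 0 ≤ w x) (hle : ∀ x, x ≠ 0 → w x ≤ 2 / |x|) :
    apChar p w (fun x => |x| ^ (p - 1)⁻¹) < ⊤ := by
  have hp' : 0 < p - 1 := sub_pos.2 hp
  refine lt_of_le_of_lt (b := ENNReal.ofReal (2 * (∫ x, w x) + 4)) ?_ ENNReal.ofReal_lt_top
  refine iSup_le fun a => iSup_le fun b => iSup_le fun hab => ENNReal.ofReal_le_ofReal ?_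
  have hI : 0 ≤ ∫ x, w x := integral_nonneg hw0
  have hba := sub_pos.2 hab
  have hR := max_abs_pos hab
  set R := max |a| |b| with hRdef
  have hσ : avgI (fun x => |x| ^ (p - 1)⁻¹) a b ^ (p - 1) ≤ R := by
    have h0 : 0 ≤ avgI (fun x => |x| ^ (p - 1)⁻¹) a b :=
      mul_nonneg (by positivity) (integral_nonneg fun x => by positivity)
    calc _ ≤ (R ^ (p - 1)⁻¹) ^ (p - 1) :=
          Real.rpow_le_rpow h0 (avgI_abs_rpow_le (by positivity) hab) hp'.le
      _ = R := Real.rpow_inv_rpow hR.le hp'.ne'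
  have hw1 : avgI w a b ≤ (2 * (∫ x, w x) + 4) / R := by
    rcases le_total (R / 2) (b - a) with h | h
    · have h1 : ∫ x in Ico a b, w x ≤ ∫ x, w x :=
        setIntegral_le_integral hw (ae_of_all _ hw0)
      calc avgI w a b ≤ (R / 2)⁻¹ * ∫ x, w x :=
            mul_le_mul (inv_anti₀ (by positivity) h) h1
              (integral_nonneg hw0) (by positivity)
        _ ≤ _ := by
            rw [le_div_iff₀ hR]
            field_simp
            linarith
    · refine avgI_le hab hw.integrableOn fun x hx => ?_
      have hx2 : R / 2 ≤ |x| := by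
        rcases max_choice |a| |b| with h' | h'
        · have := abs_sub_abs_le_abs_sub a x
          rw [abs_sub_comm, abs_of_nonneg (sub_nonneg.2 hx.1)] at this
          linarith [hx.2]
        · have := abs_sub_abs_le_abs_sub b x
          rw [abs_of_nonneg (sub_nonneg.2 hx.2.le)] at this
          linarith [hx.1]
      have hx0 : 0 < |x| := by linarith
      refine (hle x (abs_pos.1 hx0)).trans ?_
      rw [div_le_div_iff₀ hx0 hR]
      nlinarith
  calc _ ≤ (2 * (∫ x, w x) + 4) / R * R := by
        refine mul_le_mul hw1 hσ (Real.rpow_nonneg ?_ _) (by positivity)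
        exact mul_nonneg (by positivity) (integral_nonneg fun x => by positivity)
    _ = _ := div_mul_cancel₀ _ hR.ne'

theorem integrableOn_evenShellFn {β : ℝ} (hβ : 0 ≤ β) (a b : ℝ) :
    IntegrableOn (evenShellFn β) (Ico a b) := by
  refine Measure.integrableOn_of_bounded (M := 1) (by simp)
    (measurable_evenShellFn β).aestronglyMeasurable (ae_of_all _ fun x => ?_)
  rw [Real.norm_of_nonneg (evenShellFn_nonneg β x)]
  exact (evenShellFn_le β x).trans (shellDecay_le_one hβ x)

theorem evenShellFn_eq {β : ℝ} {j : ℕ} (hj : 1 ≤ j) {x : ℝ}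
    (hx : x ∈ Ico ((2 : ℝ) ^ (-(2 * j : ℤ))) (2 ^ (-(2 * j : ℤ) + 1))) :
    evenShellFn β x = (1 + 2 * j : ℝ) ^ (-β) := by
  have h1 : x < 1 := hx.2.trans_le (zpow_le_one_of_nonpos₀ one_le_two (by omega))
  have h0 : 0 < x := lt_of_lt_of_le (by positivity) hx.1
  have hs := shell_eq hx
  rw [evenShellFn, if_pos ⟨h0, h1, by rw [hs, even_neg]; exact even_two_mul _⟩, shellDecay, hs]
  push_cast
  rw [abs_neg, abs_of_nonneg (by positivity)]

theorem evenShellFn_eq_zero {β : ℝ} {i : ℤ} {x : ℝ}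
    (hx : x ∈ Ico ((2 : ℝ) ^ (2 * i - 1)) (2 ^ (2 * i))) : evenShellFn β x = 0 := by
  have hs : shell x = 2 * i - 1 := shell_eq (by simpa using hx)
  refine if_neg fun h => ?_
  have := h.2.2
  rw [hs, Int.even_iff] at this
  omega

theorem avgI_eq_const {g : ℝ → ℝ} {a b c : ℝ} (hab : a < b) (h : ∀ x ∈ Ico a b, g x = c) :
    avgI g a b = c := by
  rw [avgI, setIntegral_congr_fun measurableSet_Ico h, setIntegral_const, measureReal_def,
    Real.volume_Ico, ENNReal.toReal_ofReal (sub_pos.2 hab).le, smul_eq_mul,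
    inv_mul_cancel_left₀ (sub_pos.2 hab).ne']

theorem avgD_eq_const {g : ℝ → ℝ} {n k : ℤ} {c : ℝ} (h : ∀ x ∈ dyadicI n k, g x = c) :
    avgD g n k = c :=
  avgI_eq_const (mul_lt_mul_of_pos_right (by linarith) (by positivity)) h

theorem dyadicI_union_children (n k : ℤ) :
    dyadicI (n + 1) (2 * k) ∪ dyadicI (n + 1) (2 * k + 1) = dyadicI n k := by
  have h : (2 : ℝ) ^ (-n) = 2 * 2 ^ (-(n + 1)) := by
    rw [← zpow_one_add₀ two_ne_zero]
    congr 1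
    ring
  have hpos : (0 : ℝ) < 2 ^ (-(n + 1)) := by positivity
  simp only [dyadicI, h]
  push_cast
  rw [show ((2 : ℝ) * k + 1 + 1) * 2 ^ (-(n + 1)) = (k + 1) * (2 * 2 ^ (-(n + 1))) by ring,
    show (2 : ℝ) * k * 2 ^ (-(n + 1)) = k * (2 * 2 ^ (-(n + 1))) by ring,
    Ico_union_Ico_eq_Ico] <;> nlinarith

theorem disjoint_children (n k : ℤ) :
    Disjoint (dyadicI (n + 1) (2 * k)) (dyadicI (n + 1) (2 * k + 1)) := by
  rw [Set.disjoint_left]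
  intro x hx hx'
  have h1 := hx.2
  have h2 := hx'.1
  push_cast at h1 h2
  linarith

theorem deltaD_eq_zero_of_notMem {g : ℝ → ℝ} {n k : ℤ} {x : ℝ} (hx : x ∉ dyadicI n k) :
    deltaD g n k x = 0 := by
  rw [← dyadicI_union_children, Set.mem_union, not_or] at hx
  have hx' : x ∉ dyadicI n k := by
    rw [← dyadicI_union_children, Set.mem_union, not_or]; exact hx
  simp [deltaD, hx.1, hx.2, hx']

theorem deltaD_eq_zero_of_const {g : ℝ → ℝ} {n k : ℤ} {c : ℝ}
    (h : ∀ x ∈ dyadicI n k, g x = c) (x : ℝ) : deltaD g n k x = 0 := by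
  by_cases hx : x ∈ dyadicI n k
  · have hl : dyadicI (n + 1) (2 * k) ⊆ dyadicI n k :=
      dyadicI_union_children n k ▸ subset_union_left
    have hr : dyadicI (n + 1) (2 * k + 1) ⊆ dyadicI n k :=
      dyadicI_union_children n k ▸ subset_union_right
    have hx' := hx
    rw [← dyadicI_union_children] at hx'
    rw [deltaD, avgD_eq_const h, avgD_eq_const fun x hx => h x (hl hx),
      avgD_eq_const fun x hx => h x (hr hx)]
    rcases hx' with hx' | hx'
    · simp [hx, hx', Set.disjoint_left.1 (disjoint_children n k) hx']
    · simp [hx, hx', Set.disjoint_right.1 (disjoint_children n k) hx']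
  · exact deltaD_eq_zero_of_notMem hx

theorem dyadicI_subset_shell {j n k : ℤ} (hjn : j ≤ n) {x : ℝ} (hx : x ∈ dyadicI n k)
    (hxj : x ∈ Ico ((2 : ℝ) ^ (-j)) (2 ^ (-j + 1))) :
    dyadicI n k ⊆ Ico ((2 : ℝ) ^ (-j)) (2 ^ (-j + 1)) := by
  obtain ⟨d, rfl⟩ := Int.le.dest hjn
  have hpos : (0 : ℝ) < 2 ^ (-(j + d)) := by positivity
  have hj : (2 : ℝ) ^ (-j) = 2 ^ d * 2 ^ (-(j + d)) := by
    rw [← zpow_natCast, ← zpow_add₀ two_ne_zero]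
    congr 1
    ring
  rw [zpow_add_one₀ two_ne_zero, hj] at hxj ⊢
  have h1 : (2 : ℤ) ^ d < k + 1 := by
    have := lt_of_mul_lt_mul_right (hxj.1.trans_lt hx.2) hpos.le
    exact_mod_cast this
  have h2 : k < 2 ^ d * 2 := by
    have h := hx.1.trans_lt hxj.2
    rw [mul_right_comm] at h
    have := lt_of_mul_lt_mul_right h hpos.le
    exact_mod_cast this
  have h1' : (2 : ℝ) ^ d ≤ k := by exact_mod_cast Int.lt_add_one_iff.1 h1
  have h2' : (k : ℝ) + 1 ≤ 2 ^ d * 2 := by exact_mod_cast Int.add_one_le_iff.2 h2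
  refine Ico_subset_Ico ?_ ?_
  · exact mul_le_mul_of_nonneg_right h1' hpos.le
  · rw [mul_right_comm]
    exact mul_le_mul_of_nonneg_right h2' hpos.le

open Classical in
/-- If `g` is constant on a shell, only finitely many terms of the square function over `[0,1)`
are nonzero there. -/
theorem summable_sqFn01 {g : ℝ → ℝ} {j : ℕ} {c x : ℝ}
    (hg : ∀ y ∈ Ico ((2 : ℝ) ^ (-(j : ℤ))) (2 ^ (-(j : ℤ) + 1)), g y = c)
    (hx : x ∈ Ico ((2 : ℝ) ^ (-(j : ℤ))) (2 ^ (-(j : ℤ) + 1))) :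
    Summable fun q : ℤ × ℤ =>
      if dyadicI q.1 q.2 ⊆ Ico (0 : ℝ) 1 then (deltaD g q.1 q.2 x) ^ 2 else 0 := by
  refine summable_of_ne_finset_zero (s := Finset.Icc 0 (j : ℤ) ×ˢ {0}) ?_
  rintro ⟨n, k⟩ hq
  dsimp only
  split_ifs with hsub
  swap; · rfl
  rw [sq_eq_zero_iff]
  by_cases hxQ : x ∈ dyadicI n k
  swap; · exact deltaD_eq_zero_of_notMem hxQ
  by_cases hjn : (j : ℤ) ≤ n
  · exact deltaD_eq_zero_of_const (fun y hy => hg y (dyadicI_subset_shell hjn hxQ hx hy)) x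
  refine absurd ?_ hq
  have hx0 : 0 < x := lt_of_lt_of_le (by positivity) hx.1
  have hpos : (0 : ℝ) < 2 ^ (-n) := by positivity
  have hk1 : 0 < k + 1 := by
    have := pos_of_mul_pos_left (hx0.trans hxQ.2) hpos.le
    exact_mod_cast this
  have hxn : x < 2 ^ (-n) := hx.2.trans_le (zpow_le_zpow_right₀ one_le_two (by omega))
  have hk2 : k < 1 := by
    have h := hxQ.1.trans_lt hxn
    have := (mul_lt_iff_lt_one_left hpos).1 h
    exact_mod_cast this
  obtain rfl : k = 0 := by omega
  have hn : 0 ≤ n := by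
    have h := ((Ico_subset_Ico_iff (by simpa using hpos)).1 hsub).2
    simp only [Int.cast_zero, zero_add, one_mul] at h
    by_contra! hn
    have := one_lt_zpow₀ (one_lt_two (α := ℝ)) (show 0 < -n by omega)
    linarith
  simp only [Finset.mem_product, Finset.mem_Icc, Finset.mem_singleton]
  exact ⟨⟨hn, by omega⟩, trivial⟩

theorem le_deltaD_evenShellFn {β : ℝ} (hβ : 0 ≤ β) (i : ℕ) {x : ℝ} (hx0 : 0 < x)
    (hx : x < 2 ^ (-(2 * i + 1 : ℤ))) :
    (1 + 2 * (i + 1 : ℕ) : ℝ) ^ (-β) / 4 ≤ deltaD (evenShellFn β) (2 * i) 0 x := by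
  set g := evenShellFn β
  set t : ℝ := 2 ^ (-(2 * i + 1 : ℤ)) with ht
  have htpos : 0 < t := by positivity
  have h2t : (2 : ℝ) ^ (-(2 * i : ℤ)) = 2 * t := by
    rw [ht, ← zpow_one_add₀ two_ne_zero]; congr 1; ring
  have hmemL : x ∈ dyadicI (2 * i + 1) (2 * 0) := by
    simp only [dyadicI, ← ht]; simpa using ⟨hx0.le, hx⟩
  have hmem : x ∈ dyadicI (2 * i) 0 := by
    rw [← dyadicI_union_children]; exact Or.inl hmemL
  have hnot := Set.disjoint_left.1 (disjoint_children (2 * i) 0) hmemL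
  have hzero : ∫ y in Ico t (2 * t), g y = 0 := by
    refine setIntegral_eq_zero_of_forall_eq_zero fun y hy => ?_
    refine evenShellFn_eq_zero (i := -i) ?_
    rw [show 2 * (-(i : ℤ)) - 1 = -(2 * i + 1) by ring, ← ht,
      show 2 * (-(i : ℤ)) = -(2 * i) by ring, h2t]
    exact hy
  have hQ : ∫ y in Ico 0 (2 * t), g y = ∫ y in Ico 0 t, g y := by
    rw [← Ico_union_Ico_eq_Ico htpos.le (show t ≤ 2 * t by linarith),
      setIntegral_union Ico_disjoint_Ico_same measurableSet_Ico
        (integrableOn_evenShellFn hβ _ _) (integrableOn_evenShellFn hβ _ _), hzero, add_zero]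
  have hlow : t / 2 * (1 + 2 * (i + 1 : ℕ) : ℝ) ^ (-β) ≤ ∫ y in Ico 0 t, g y := by
    have hsub : Ico (t / 2) t ⊆ Ico 0 t := Ico_subset_Ico_left (by positivity)
    have hle := setIntegral_mono_set (integrableOn_evenShellFn hβ 0 t)
      (ae_of_all _ (evenShellFn_nonneg β)) hsub.eventuallyLE
    refine le_trans (le_of_eq ?_) hle
    have hconst : ∀ y ∈ Ico (t / 2) t, evenShellFn β y = (1 + 2 * (i + 1 : ℕ) : ℝ) ^ (-β) := by
      intro y hy
      refine evenShellFn_eq (by omega) ?_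
      rw [show -(2 * ((i + 1 : ℕ) : ℤ)) = -(2 * i + 1) - 1 by push_cast; ring,
        zpow_sub_one₀ two_ne_zero, sub_add_cancel, ← ht]
      exact hy
    rw [setIntegral_congr_fun measurableSet_Ico hconst, setIntegral_const, measureReal_def,
      Real.volume_Ico, ENNReal.toReal_ofReal (by linarith), smul_eq_mul]
    ring
  have hL : avgD g (2 * i + 1) (2 * 0) = t⁻¹ * ∫ y in Ico 0 t, g y := by
    simp only [avgD, avgI, ← ht]
    simp
  have hQ' : avgD g (2 * i) 0 = (2 * t)⁻¹ * ∫ y in Ico 0 t, g y := by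
    rw [← hQ]
    simp [avgD, avgI, h2t]
  rw [deltaD, indicator_of_mem hmemL, indicator_of_notMem hnot, indicator_of_mem hmem, hL, hQ']
  calc _ = (2 * t)⁻¹ * (t / 2 * (1 + 2 * (i + 1 : ℕ) : ℝ) ^ (-β)) := by field_simp; ring
    _ ≤ (2 * t)⁻¹ * ∫ y in Ico 0 t, g y := by gcongr
    _ = _ := by field_simp; ring

theorem le_sqFn01_evenShellFn {β : ℝ} (hβ : 0 ≤ β) (m : ℕ) {x : ℝ}
    (hx : x ∈ Ico ((2 : ℝ) ^ (-(2 * (m + 1 : ℕ) : ℤ))) (2 ^ (-(2 * (m + 1 : ℕ) : ℤ) + 1))) :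
    √((1 + 2 * (m + 1 : ℕ) : ℝ) ^ (1 - 2 * β) / 48) ≤ sqFn01 (evenShellFn β) x := by
  classical
  have hx0 : 0 < x := lt_of_lt_of_le (by positivity) hx.1
  have hsum := summable_sqFn01 (g := evenShellFn β) (j := 2 * (m + 1)) (x := x)
    (fun y hy => evenShellFn_eq (j := m + 1) (by omega) (by exact_mod_cast hy))
    (by exact_mod_cast hx)
  refine Real.sqrt_le_sqrt ?_
  set t : ℝ := 1 + 2 * (m + 1 : ℕ) with ht
  have htpos : 0 < t := by positivity
  have hinj : Function.Injective fun i : ℕ => ((2 * i : ℤ), (0 : ℤ)) := by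
    intro i i' h
    have := congrArg Prod.fst h
    dsimp only at this
    omega
  have hfin := hsum.sum_le_tsum ((Finset.range (m + 1)).map ⟨_, hinj⟩)
    fun q _ => by split_ifs <;> positivity
  rw [Finset.sum_map] at hfin
  refine le_trans ?_ (hfin.trans (le_of_eq ?_))
  swap
  · congr! 2
  have hterm : ∀ i ∈ Finset.range (m + 1), (t ^ (-β) / 4) ^ 2 ≤
      if dyadicI (2 * i) 0 ⊆ Ico (0 : ℝ) 1 then (deltaD (evenShellFn β) (2 * i) 0 x) ^ 2
      else 0 := by
    intro i hi
    have him : i ≤ m := by simpa [Nat.lt_succ_iff] using hi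
    rw [if_pos]
    · have hxi : x < 2 ^ (-(2 * i + 1 : ℤ)) :=
        hx.2.trans_le (zpow_le_zpow_right₀ one_le_two (by push_cast; omega))
      refine pow_le_pow_left₀ (by positivity) ?_ 2
      refine le_trans ?_ (le_deltaD_evenShellFn hβ i hx0 hxi)
      have : (1 + 2 * (i + 1 : ℕ) : ℝ) ≤ t := by rw [ht]; gcongr
      have := Real.rpow_le_rpow_of_nonpos (by positivity) this (neg_nonpos.2 hβ)
      linarith
    · refine Ico_subset_Ico (by simp) ?_
      simpa using zpow_le_one_of_nonpos₀ (one_le_two (α := ℝ)) (show -(2 * (i : ℤ)) ≤ 0 by omega)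
  refine le_trans ?_ (Finset.sum_le_sum hterm)
  rw [Finset.sum_const, Finset.card_range, nsmul_eq_mul]
  have hpow : t ^ (1 - 2 * β) = t * (t ^ (-β)) ^ 2 := by
    rw [← Real.rpow_natCast, ← Real.rpow_mul htpos.le]
    nth_rewrite 2 [← Real.rpow_one t]
    rw [← Real.rpow_add htpos]
    congr 1
    push_cast
    ring
  rw [hpow]
  have : t ≤ 3 * ((m + 1 : ℕ) : ℝ) := by rw [ht]; push_cast; linarith
  have h2 : 0 ≤ (t ^ (-β)) ^ 2 := by positivity
  nlinarith [mul_le_mul_of_nonneg_right this h2]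

theorem pNorm01_sqFn01_evenShellFn {p β : ℝ} (hp : 0 < p) (hβ : 0 ≤ β) :
    pNorm01 p (sqFn01 (evenShellFn β)) (shellWeight (1 + (1 - 2 * β) * (p / 2))) = ⊤ := by
  set s := 1 + (1 - 2 * β) * (p / 2) with hs
  set K : ℕ → Set ℝ := fun m =>
    Ico ((2 : ℝ) ^ (-(2 * (m + 1 : ℕ) : ℤ))) (2 ^ (-(2 * (m + 1 : ℕ) : ℤ) + 1))
  have hdisj : Pairwise (Function.onFun Disjoint K) := by
    intro m m' hne
    refine Set.disjoint_left.2 fun x hx hx' => hne ?_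
    have := (shell_eq hx).symm.trans (shell_eq hx')
    omega
  have hsub : ⋃ m, K m ⊆ Ico 0 1 := by
    refine iUnion_subset fun m => Ico_subset_Ico (by positivity) ?_
    exact zpow_le_one_of_nonpos₀ one_le_two (by push_cast; omega)
  have hpt : ∀ m, ∀ x ∈ K m, (1 / 48 : ℝ) ^ (p / 2) * (1 + 2 * (m + 1 : ℕ) : ℝ)⁻¹ *
      2 ^ (2 * (m + 1 : ℕ) : ℤ) ≤ |sqFn01 (evenShellFn β) x| ^ p * shellWeight s x := by
    intro m x hx
    have hS := le_sqFn01_evenShellFn hβ m hx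
    have hw : shellWeight s x =
        2 ^ (2 * (m + 1 : ℕ) : ℤ) * (1 + 2 * (m + 1 : ℕ) : ℝ) ^ (-s) := by
      rw [shellWeight, shellDecay, shell_eq hx, neg_neg]
      push_cast
      rw [abs_neg, abs_of_nonneg (by positivity)]
    rw [hw]
    set t : ℝ := 1 + 2 * (m + 1 : ℕ) with ht
    have htpos : 0 < t := by positivity
    have hSp : t ^ ((1 - 2 * β) * (p / 2)) * (1 / 48) ^ (p / 2) ≤
        |sqFn01 (evenShellFn β) x| ^ p := by
      calc _ = √(t ^ (1 - 2 * β) / 48) ^ p := by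
            rw [Real.sqrt_eq_rpow, ← Real.rpow_mul (by positivity), div_eq_mul_one_div (t ^ _),
              Real.mul_rpow (by positivity) (by positivity), Real.rpow_mul htpos.le,
              one_div_mul_eq_div]
        _ ≤ _ := Real.rpow_le_rpow (Real.sqrt_nonneg _) (hS.trans (le_abs_self _)) hp.le
    calc _ = t ^ ((1 - 2 * β) * (p / 2)) * (1 / 48) ^ (p / 2) *
          (2 ^ (2 * (m + 1 : ℕ) : ℤ) * t ^ (-s)) := by
          have : t⁻¹ = t ^ ((1 - 2 * β) * (p / 2)) * t ^ (-s) := by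
            rw [← Real.rpow_add htpos, ← Real.rpow_neg_one]
            congr 1
            rw [hs]; ring
          rw [this]; ring
      _ ≤ _ := by gcongr
  have hdiv : ∑' m : ℕ, ENNReal.ofReal ((1 / 48 : ℝ) ^ (p / 2) * (1 + 2 * (m + 1 : ℕ) : ℝ)⁻¹) =
      ⊤ := by
    by_contra hne
    have hsum := ENNReal.summable_toReal hne
    refine Real.not_summable_one_div_natCast ?_
    rw [← summable_nat_add_iff 1]
    refine Summable.of_nonneg_of_le (fun m => by positivity) (fun m => ?_)
      (hsum.mul_left (3 * ((1 / 48 : ℝ) ^ (p / 2))⁻¹))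
    rw [ENNReal.toReal_ofReal (by positivity)]
    field_simp
    push_cast
    linarith
  have htop : ∫⁻ x in Ico (0 : ℝ) 1,
      ENNReal.ofReal (|sqFn01 (evenShellFn β) x| ^ p * shellWeight s x) = ⊤ := by
    refine top_le_iff.1 ?_
    calc ⊤ = ∑' m : ℕ, ENNReal.ofReal
          ((1 / 48 : ℝ) ^ (p / 2) * (1 + 2 * (m + 1 : ℕ) : ℝ)⁻¹) := hdiv.symm
      _ ≤ ∑' m, ∫⁻ x in K m,
          ENNReal.ofReal (|sqFn01 (evenShellFn β) x| ^ p * shellWeight s x) := by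
          refine ENNReal.tsum_le_tsum fun m => ?_
          refine le_trans (le_of_eq ?_) (setLIntegral_mono' measurableSet_Ico
            fun x hx => ENNReal.ofReal_le_ofReal (hpt m x hx))
          rw [setLIntegral_const, Real.volume_Ico, ← ENNReal.ofReal_mul (by positivity),
            zpow_add_one₀ two_ne_zero, zpow_neg]
          congr 1
          field_simp
          ring
      _ = ∫⁻ x in ⋃ m, K m,
          ENNReal.ofReal (|sqFn01 (evenShellFn β) x| ^ p * shellWeight s x) :=
          (lintegral_iUnion (fun _ => measurableSet_Ico) hdisj _).symm
      _ ≤ _ := lintegral_mono_set hsub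
  rw [pNorm01, htop, ENNReal.top_rpow_of_pos (by positivity)]

theorem pNorm_evenShellFn_div_lt_top {p β : ℝ} (hp : 1 < p) (hβ : 1 < β * p) :
    pNorm p (fun x => evenShellFn β x / |x| ^ (p - 1)⁻¹) (fun x => |x| ^ (p - 1)⁻¹) < ⊤ := by
  have hp' : 0 < p - 1 := sub_pos.2 hp
  refine ENNReal.rpow_lt_top_of_nonneg (by positivity) (ne_of_lt ?_)
  refine lt_of_le_of_lt (lintegral_mono fun x => ENNReal.ofReal_le_ofReal ?_)
    (lintegral_shellWeight_lt_top hβ)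
  rcases eq_or_ne x 0 with rfl | hx
  · have : (0 : ℝ) ^ (p - 1)⁻¹ = 0 := Real.zero_rpow (by positivity)
    simpa [this] using (shellWeight_pos (β * p) 0).le
  have hx' := abs_pos.2 hx
  have hσ : 0 < |x| ^ (p - 1)⁻¹ := by positivity
  have hσp : (|x| ^ (p - 1)⁻¹) ^ p = |x| * |x| ^ (p - 1)⁻¹ := by
    rw [← Real.rpow_mul hx'.le, ← Real.rpow_one_add' hx'.le (by positivity)]
    congr 1
    field_simp
    ring
  have hg : evenShellFn β x ^ p ≤ shellDecay (β * p) x := by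
    refine (Real.rpow_le_rpow (evenShellFn_nonneg β x) (evenShellFn_le β x)
      (by linarith)).trans_eq ?_
    rw [shellDecay, shellDecay, ← Real.rpow_mul (by positivity), neg_mul]
  rw [abs_of_nonneg (div_nonneg (evenShellFn_nonneg β x) hσ.le),
    Real.div_rpow (evenShellFn_nonneg β x) hσ.le, hσp]
  calc _ = |x|⁻¹ * evenShellFn β x ^ p := by field_simp
    _ ≤ _ := mul_le_mul (inv_abs_le_zpow_neg_shell hx) hg
      (Real.rpow_nonneg (evenShellFn_nonneg β x) p) (by positivity)

/-- For `p ∈ (2,∞)` there exist weights `w, σ` on `ℝ` with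
`[σ]_{A_∞} < ∞` and `[w,σ]_{A_p} < ∞`, and `f ∈ L^p(σ)` supported in `[0,1]`,
such that `S(fσ) ∉ L^p(w)`, where `S` is (even just) the dyadic square function
over `[0,1)`. -/
theorem statement0 (p : ℝ) (hp : 2 < p) :
    ∃ w σ : ℝ → ℝ, IsWeight w ∧ IsWeight σ ∧
      ainfChar σ < ⊤ ∧ apChar p w σ < ⊤ ∧
      ∃ f : ℝ → ℝ, Measurable f ∧ pNorm p f σ < ⊤ ∧
        (∀ x : ℝ, x ∉ Set.Icc (0:ℝ) 1 → f x = 0) ∧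
        pNorm01 p (sqFn01 (fun x => f x * σ x)) w = ⊤ := by
  have hp1 : 1 < p := by linarith
  have hp' : 0 < p - 1 := by linarith
  set β : ℝ := 1 / (2 * p) + 1 / 4 with hβ
  have hβ0 : 0 ≤ β := by positivity
  have hβp : β * p = 1 / 2 + p / 4 := by rw [hβ]; field_simp
  have hs : 1 < 1 + (1 - 2 * β) * (p / 2) := by nlinarith
  refine ⟨shellWeight (1 + (1 - 2 * β) * (p / 2)), fun x => |x| ^ (p - 1)⁻¹,
    isWeight_shellWeight hs, isWeight_abs_rpow (by positivity),
    ainfChar_abs_rpow_lt_top (by positivity),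
    apChar_lt_top hp1 (integrable_shellWeight hs) (fun x => (shellWeight_pos _ x).le)
      (fun x hx => shellWeight_le (by linarith) hx),
    fun x => evenShellFn β x / |x| ^ (p - 1)⁻¹,
    (measurable_evenShellFn β).div (continuous_abs_rpow (by positivity)).measurable,
    pNorm_evenShellFn_div_lt_top hp1 (by linarith), fun x hx => ?_, ?_⟩
  · have : evenShellFn β x = 0 := if_neg fun h => hx ⟨h.1.le, h.2.1.le⟩
    simp [this]
  · have hfσ : (fun x => evenShellFn β x / |x| ^ (p - 1)⁻¹ * |x| ^ (p - 1)⁻¹) =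
        evenShellFn β := by
      funext x
      by_cases hx : 0 < x
      · exact div_mul_cancel₀ _ (Real.rpow_pos_of_pos (abs_pos.2 hx.ne') _).ne'
      · have : evenShellFn β x = 0 := if_neg fun h => hx h.1
        simp [this]
    rw [hfσ]
    exact pNorm01_sqFn01_evenShellFn (by linarith) hβ0

end
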